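/- Under Assumptions B and C, if (u_n) is a sequence of integers with u_n ∼ n P(H > γM_n), w_n := n − u_n and v_n := [n^{1−β} u_n^β] − u_n, then (w_n P(H > γM_n)/√v_n) · log( γM_n / b(w_n/v_n) ) → 0 as n → ∞. -/

import Mathlib

open MeasureTheory ProbabilityTheory Filter Topology Set Asymptotics

noncomputable section

variable {Ω : Type*} [MeasureSpace Ω]

/-- The `k`-th largest order statistic (1-indexed) of the finite sample `f`,
so `orderStat f 1 ≥ orderStat f 2 ≥ … ≥ orderStat f n`. -/
def orderStat {n : ℕ} (f : Fin n → ℝ) (k : ℕ) : ℝ :=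
  if h : n - k < n then f (Tuple.sort f ⟨n - k, h⟩) else 0

/-- The Hill statistic `h(k,n) = (1/k) ∑_{i=1}^k log (X_{(i)} / X_{(k)})`. -/
def hill {n : ℕ} (f : Fin n → ℝ) (k : ℕ) : ℝ :=
  (k : ℝ)⁻¹ * ∑ i ∈ Finset.Icc 1 k, Real.log (orderStat f i / orderStat f k)

/-- Tail probability `x ↦ P(Z > x)`. -/
def tailP (Z : Ω → ℝ) (x : ℝ) : ℝ := (ℙ {ω | Z ω > x}).toReal

/-- `b(y) := inf {x : 1/P(H > x) ≥ y}`. -/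
def bq (Z : Ω → ℝ) (y : ℝ) : ℝ := sInf {x : ℝ | 1 / tailP Z x ≥ y}

/-- `l(x) := x^α P(H > x)`. -/
def ell (α : ℝ) (Z : Ω → ℝ) (x : ℝ) : ℝ := x ^ α * tailP Z x

/-- The tail of `H` is regularly varying with index `-α`. -/
def RegVarTail (H0 : Ω → ℝ) (α : ℝ) : Prop :=
  ∀ x : ℝ, 0 < x → Tendsto (fun t => tailP H0 (t * x) / tailP H0 t) atTop (𝓝 (x ^ (-α)))

/-- A function is regularly varying (at infinity) with index `σ`. -/
def RegVarFun (A : ℝ → ℝ) (σ : ℝ) : Prop :=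
  ∀ x : ℝ, 0 < x → Tendsto (fun t => A (t * x) / A t) atTop (𝓝 (x ^ σ))

/-- Assumption A: there is a sequence `(ε_n)` with
`P(H > M_n)^{-(1-β)} ε_n → 0`, `n P(H > M_n) P(L > ε_n M_n) → 0` and
`P(H > M_n)^{-(1-β)} (l(γ M_n (1+ε_n))/l(γ M_n) - 1) → 0`. -/
def AssumpA (H0 L0 : Ω → ℝ) (M : ℕ → ℝ) (α β γ : ℝ) : Prop :=
  ∃ ε : ℕ → ℝ,
    Tendsto (fun n : ℕ => tailP H0 (M n) ^ (-(1 - β)) * ε n) atTop (𝓝 0) ∧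
    Tendsto (fun n : ℕ => (n : ℝ) * tailP H0 (M n) * tailP L0 (ε n * M n)) atTop (𝓝 0) ∧
    Tendsto (fun n : ℕ => tailP H0 (M n) ^ (-(1 - β)) *
      (ell α H0 (γ * M n * (1 + ε n)) / ell α H0 (γ * M n) - 1)) atTop (𝓝 0)

/-- Assumption B: `n P(H > M_n) → ∞`. -/
def AssumpB (H0 : Ω → ℝ) (M : ℕ → ℝ) : Prop :=
  Tendsto (fun n : ℕ => (n : ℝ) * tailP H0 (M n)) atTop atTop

/-- Assumption C: `n P(H > M_n)^{2-β} (log M_n)² → 0`. -/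
def AssumpC (H0 : Ω → ℝ) (M : ℕ → ℝ) (β : ℝ) : Prop :=
  Tendsto (fun n : ℕ => (n : ℝ) * tailP H0 (M n) ^ (2 - β) * Real.log (M n) ^ 2) atTop (𝓝 0)

/-- Assumption D: for any sequence `(v_n)` with `v_n ∼ n P(H > γ M_n)^β`,
`√v_n [(n/v_n) P(H > b(n/v_n) y^{-1/α}) - y] → 0` uniformly on compact subsets of `[0,∞)`
(with the convention that `P(H > b(n/v_n) · 0^{-1/α}) = P(H > ∞) = 0` at `y = 0`). -/
def AssumpD (H0 : Ω → ℝ) (M : ℕ → ℝ) (α β γ : ℝ) : Prop :=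
  ∀ v : ℕ → ℝ,
    Tendsto (fun n : ℕ => v n / ((n : ℝ) * tailP H0 (γ * M n) ^ β)) atTop (𝓝 1) →
    ∀ K : Set ℝ, K ⊆ Ici 0 → IsCompact K →
      TendstoUniformlyOn
        (fun (n : ℕ) (y : ℝ) => Real.sqrt (v n) *
          (((n : ℝ) / v n) *
              (if y = 0 then 0 else tailP H0 (bq H0 ((n : ℝ) / v n) * y ^ (-α⁻¹))) - y))
        0 atTop K

/-- Assumption E: for any sequence `(v_n)` with `v_n ∼ n P(H > γ M_n)^β`,
`lim_{T→∞} limsup_n √v_n ∫_T^∞ |(n/v_n) P(H > b(n/v_n) s) - s^{-α}| ds/s = 0`. -/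
def AssumpE (H0 : Ω → ℝ) (M : ℕ → ℝ) (α β γ : ℝ) : Prop :=
  ∀ v : ℕ → ℝ,
    Tendsto (fun n : ℕ => v n / ((n : ℝ) * tailP H0 (γ * M n) ^ β)) atTop (𝓝 1) →
    Tendsto (fun T : ℝ =>
        Filter.limsup (fun n : ℕ => Real.sqrt (v n) *
          ∫ s in Ioi T,
            |((n : ℝ) / v n) * tailP H0 (bq H0 ((n : ℝ) / v n) * s) - s ^ (-α)| / s) atTop)
      atTop (𝓝 0)

/-- `w_n := n - u_n`. -/
def wseq (u : ℕ → ℕ) (n : ℕ) : ℕ := n - u n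

/-- `v_n := ⌊n^{1-β} u_n^β⌋ - u_n`. -/
def vseq (u : ℕ → ℕ) (β : ℝ) (n : ℕ) : ℕ :=
  ⌊(n : ℝ) ^ (1 - β) * (u n : ℝ) ^ β⌋₊ - u n

lemma tailP_nonneg (Z : Ω → ℝ) (x : ℝ) : 0 ≤ tailP Z x := ENNReal.toReal_nonneg

lemma tailP_antitone [IsFiniteMeasure (ℙ : Measure Ω)] (Z : Ω → ℝ) : Antitone (tailP Z) := by
  intro x y hxy
  refine ENNReal.toReal_mono (measure_ne_top _ _) (measure_mono fun ω hω => ?_)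
  exact lt_of_le_of_lt hxy hω

lemma tailP_tendsto_zero [IsFiniteMeasure (ℙ : Measure Ω)] {Z : Ω → ℝ} (hZ : Measurable Z) :
    Tendsto (tailP Z) atTop (𝓝 0) := by
  have h : Tendsto (fun x : ℝ => (ℙ : Measure Ω) {ω | Z ω > x}) atTop
      (𝓝 (ℙ (⋂ x : ℝ, {ω | Z ω > x}))) := by
    refine tendsto_measure_iInter_atTop (fun x => ?_) (fun x y hxy ω hω => ?_) ⟨0, measure_ne_top _ _⟩
    · exact (measurableSet_lt measurable_const hZ).nullMeasurableSet
    · exact lt_of_le_of_lt hxy hω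
  have he : (⋂ x : ℝ, {ω | Z ω > x}) = ∅ := by
    ext ω
    simp only [mem_iInter, mem_ofPred_eq, mem_empty_iff_false, iff_false, not_forall]
    exact ⟨Z ω, lt_irrefl _⟩
  rw [he, measure_empty] at h
  exact (ENNReal.tendsto_toReal ENNReal.zero_ne_top).comp h

lemma RegVarTail.tailP_pos [IsFiniteMeasure (ℙ : Measure Ω)] {Z : Ω → ℝ} {α : ℝ}
    (h : RegVarTail Z α) (x : ℝ) : 0 < tailP Z x := by
  have h1 := h 1 one_pos
  rw [Real.one_rpow] at h1
  obtain ⟨t, ht, hxt⟩ := ((h1.eventually_ne one_ne_zero).and (eventually_ge_atTop x)).exists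
  have ht0 : tailP Z t ≠ 0 := fun h0 => ht (by rw [h0, div_zero])
  exact ((tailP_nonneg Z t).lt_of_ne' ht0).trans_le (tailP_antitone Z hxt)

/-- A point whose reciprocal tail is below `y` is a lower bound of the set defining `b(y)`. -/
lemma mem_lowerBounds_of_one_div_tailP_lt [IsFiniteMeasure (ℙ : Measure Ω)] {Z : Ω → ℝ} {x y : ℝ}
    (hx : 0 < tailP Z x) (hy : 1 / tailP Z x < y) :
    x ∈ lowerBounds {z : ℝ | 1 / tailP Z z ≥ y} := by
  intro z hz
  by_contra! hzx
  have h := one_div_le_one_div_of_le hx (tailP_antitone Z hzx.le)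
  exact absurd (hy.trans_le (le_trans hz h)) (lt_irrefl _)

/-- With `q = P(H > γ M_n)`, the sequence `v_n` is squeezed between multiples of `n q^β`. -/
lemma vseq_bounds {β : ℝ} (hβ : β ∈ Ioo (0 : ℝ) 1) {q : ℕ → ℝ} (hqpos : ∀ n, 0 < q n)
    (hq0 : Tendsto q atTop (𝓝 0)) (hnq : Tendsto (fun n : ℕ => (n : ℝ) * q n) atTop atTop)
    {u : ℕ → ℕ} (hu : Tendsto (fun n : ℕ => (u n : ℝ) / ((n : ℝ) * q n)) atTop (𝓝 1)) :
    ∀ᶠ n : ℕ in atTop, (n : ℝ) * q n ^ β / 2 ≤ vseq u β n ∧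
      (vseq u β n : ℝ) ≤ 2 * ((n : ℝ) * q n ^ β) := by
  have hβ' : 0 < 1 - β := by linarith [hβ.2]
  have hsβ : Tendsto (fun n : ℕ => ((u n : ℝ) / ((n : ℝ) * q n)) ^ β) atTop (𝓝 1) := by
    simpa using hu.rpow_const (p := β) (Or.inl one_ne_zero)
  have hq1 : Tendsto (fun n => q n ^ (1 - β)) atTop (𝓝 0) := by
    simpa [Real.zero_rpow hβ'.ne'] using hq0.rpow_const (p := 1 - β) (Or.inr hβ'.le)
  have hsq : Tendsto (fun n : ℕ => (u n : ℝ) / ((n : ℝ) * q n) * q n ^ (1 - β)) atTop (𝓝 0) := by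
    simpa using hu.mul hq1
  filter_upwards [hsβ.eventually (Ioo_mem_nhds (show (3 / 4 : ℝ) < 1 by norm_num) one_lt_two),
    hsq.eventually (gt_mem_nhds (show (0 : ℝ) < 1 / 8 by norm_num)),
    hnq.eventually_ge_atTop 8, hq0.eventually (gt_mem_nhds one_pos),
    eventually_gt_atTop 0] with n h1 h2 h3 h4 hn
  have hn0 : (0 : ℝ) < n := Nat.cast_pos.2 hn
  have hq := hqpos n
  have hqq : q n ^ β * q n ^ (1 - β) = q n := by
    rw [← Real.rpow_add hq, add_sub_cancel, Real.rpow_one]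
  have hnn : (n : ℝ) ^ (1 - β) * (n : ℝ) ^ β = n := by
    rw [← Real.rpow_add hn0, sub_add_cancel, Real.rpow_one]
  set s := (u n : ℝ) / ((n : ℝ) * q n) with hs
  have hs0 : 0 ≤ s := by positivity
  have hus : (u n : ℝ) = s * ((n : ℝ) * q n) := by rw [hs]; field_simp
  set D := (n : ℝ) * q n ^ β with hD
  have hD0 : 0 < D := by positivity
  have hA : (n : ℝ) ^ (1 - β) * (u n : ℝ) ^ β = s ^ β * D := by
    rw [hus, Real.mul_rpow hs0 (by positivity), Real.mul_rpow hn0.le hq.le, hD]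
    linear_combination (s ^ β * q n ^ β) * hnn
  have huD : (u n : ℝ) = s * q n ^ (1 - β) * D := by
    rw [hus, hD]
    linear_combination (-(s * n)) * hqq
  have hD8 : 8 ≤ D := by
    refine h3.trans (mul_le_mul_of_nonneg_left ?_ hn0.le)
    simpa using Real.rpow_le_rpow_of_exponent_ge hq h4.le hβ.2.le
  have hub : (u n : ℝ) ≤ 1 / 8 * D := by
    rw [huD]; exact mul_le_mul_of_nonneg_right h2.le hD0.le
  have hA0 : 0 ≤ s ^ β * D := by positivity
  unfold vseq
  rw [hA]
  constructor
  · have hf := Nat.lt_floor_add_one (s ^ β * D)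
    have hle : ((⌊s ^ β * D⌋₊ : ℕ) : ℝ) ≤ ((⌊s ^ β * D⌋₊ - u n : ℕ) : ℝ) + u n := by
      exact_mod_cast le_tsub_add
    nlinarith [mul_le_mul_of_nonneg_right h1.1.le hD0.le]
  · have hle : ((⌊s ^ β * D⌋₊ - u n : ℕ) : ℝ) ≤ (⌊s ^ β * D⌋₊ : ℕ) := by
      exact_mod_cast Nat.sub_le _ _
    exact (hle.trans (Nat.floor_le hA0)).trans (mul_le_mul_of_nonneg_right h1.2.le hD0.le)

/-- Under Assumptions B and C,
`(w_n P(H > γ M_n)/√v_n) log (γ M_n / b(w_n/v_n)) → 0`. -/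
theorem log_ratio_rate_tendsto_zero
    {Ω : Type*} [MeasureSpace Ω] [IsProbabilityMeasure (ℙ : Measure Ω)]
    (H0 : Ω → ℝ) (hH0meas : Measurable H0) (hH0nn : ∀ ω, 0 ≤ H0 ω)
    (α β γ : ℝ) (hα : 0 < α) (hβ : β ∈ Ioo (0:ℝ) 1) (hγ : γ ∈ Ioo (0:ℝ) 1)
    (hreg : RegVarTail H0 α)
    (M : ℕ → ℝ) (hMpos : ∀ n, 0 < M n) (hMtop : Tendsto M atTop atTop)
    (hB : AssumpB H0 M) (hC : AssumpC H0 M β)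
    (u : ℕ → ℕ)
    (hu : Tendsto (fun n : ℕ => (u n : ℝ) / ((n : ℝ) * tailP H0 (γ * M n))) atTop (𝓝 1))
 :
    Tendsto
      (fun n : ℕ => (wseq u n : ℝ) * tailP H0 (γ * M n) / Real.sqrt (vseq u β n) *
        Real.log (γ * M n / bq H0 ((wseq u n : ℝ) / (vseq u β n : ℝ))))
      atTop (𝓝 0) := by
  have hβ' : 0 < 1 - β := by linarith [hβ.2]
  have h2β : 0 < 2 - β := by linarith
  set q : ℕ → ℝ := fun n => tailP H0 (γ * M n) with hqdef
  have hqpos : ∀ n, 0 < q n := fun n => hreg.tailP_pos _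
  have hγM : Tendsto (fun n => γ * M n) atTop atTop := hMtop.const_mul_atTop hγ.1
  have hq0 : Tendsto q atTop (𝓝 0) := (tailP_tendsto_zero hH0meas).comp hγM
  have hr : Tendsto (fun n => q n / tailP H0 (M n)) atTop (𝓝 (γ ^ (-α))) := by
    refine ((hreg γ hγ.1).comp hMtop).congr fun n => ?_
    simp [hqdef, mul_comm]
  have hMq : ∀ n, tailP H0 (M n) ≤ q n := fun n =>
    tailP_antitone H0 (by nlinarith [hMpos n, hγ.2])
  have hnq : Tendsto (fun n : ℕ => (n : ℝ) * q n) atTop atTop :=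
    tendsto_atTop_mono (fun n => mul_le_mul_of_nonneg_left (hMq n) n.cast_nonneg) hB
  have hqβ : Tendsto (fun n => q n ^ β) atTop (𝓝 0) := by
    simpa [Real.zero_rpow hβ.1.ne'] using hq0.rpow_const (p := β) (Or.inr hβ.1.le)
  have hq1 : Tendsto (fun n => q n ^ (1 - β)) atTop (𝓝 0) := by
    simpa [Real.zero_rpow hβ'.ne'] using hq0.rpow_const (p := 1 - β) (Or.inr hβ'.le)
  have hsq : Tendsto (fun n : ℕ => (u n : ℝ) / ((n : ℝ) * q n) * q n) atTop (𝓝 0) := by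
    simpa using hu.mul hq0
  have hbound : Tendsto (fun n : ℕ => Real.sqrt (2 * ((q n / tailP H0 (M n)) ^ (2 - β) *
      ((n : ℝ) * tailP H0 (M n) ^ (2 - β) * Real.log (M n) ^ 2)))) atTop (𝓝 0) := by
    have h := (((hr.rpow_const (p := 2 - β) (Or.inr h2β.le)).mul hC).const_mul 2).sqrt
    simpa using h
  have hT1 := hreg.tailP_pos 1
  refine squeeze_zero' ?_ ?_ hbound
  all_goals
    filter_upwards [vseq_bounds hβ hqpos hq0 hnq hu,
      hsq.eventually (gt_mem_nhds (show (0 : ℝ) < 1 / 2 by norm_num)),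
      hqβ.eventually (gt_mem_nhds (show (0 : ℝ) < tailP H0 1 / 4 by positivity)),
      hq1.eventually (gt_mem_nhds (show (0 : ℝ) < 1 / 2 by norm_num)),
      hMtop.eventually_ge_atTop 1, eventually_gt_atTop 0] with n hv hun hqT hq2 hM1 hn
    have hn0 : (0 : ℝ) < n := Nat.cast_pos.2 hn
    have hq := hqpos n
    have hqb : 0 < q n ^ β := Real.rpow_pos_of_pos hq _
    have hv0 : (0 : ℝ) < vseq u β n := lt_of_lt_of_le (by positivity) hv.1
    have hw : (wseq u n : ℝ) ≤ n := by exact_mod_cast Nat.sub_le _ _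
    have hw' : (n : ℝ) / 2 ≤ wseq u n := by
      have h1 : (n : ℝ) ≤ wseq u n + u n := by exact_mod_cast le_tsub_add
      have h2 : (u n : ℝ) = (u n : ℝ) / ((n : ℝ) * q n) * q n * n := by field_simp
      nlinarith
    have hqq : q n ^ β * q n ^ (1 - β) = q n := by
      rw [← Real.rpow_add hq, add_sub_cancel, Real.rpow_one]
    have hlow : 1 / tailP H0 1 < (wseq u n : ℝ) / vseq u β n := by
      rw [div_lt_div_iff₀ hT1 hv0]
      nlinarith [mul_lt_mul_of_pos_left hqT hn0]
    have hup : (wseq u n : ℝ) / vseq u β n ≤ 1 / q n := by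
      rw [div_le_div_iff₀ hv0 hq]
      have h1 : q n ≤ q n ^ β / 2 := by nlinarith
      nlinarith [mul_le_mul_of_nonneg_left h1 hn0.le]
    have hlb := mem_lowerBounds_of_one_div_tailP_lt hT1 hlow
    have hmem : γ * M n ∈ {z : ℝ | 1 / tailP H0 z ≥ (wseq u n : ℝ) / vseq u β n} := hup
    have hb1 : 1 ≤ bq H0 ((wseq u n : ℝ) / vseq u β n) := le_csInf ⟨_, hmem⟩ hlb
    have hb2 : bq H0 ((wseq u n : ℝ) / vseq u β n) ≤ γ * M n := csInf_le ⟨1, hlb⟩ hmem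
    have hb0 := one_pos.trans_le hb1
    have hlog0 : 0 ≤ Real.log (γ * M n / bq H0 ((wseq u n : ℝ) / vseq u β n)) :=
      Real.log_nonneg ((one_le_div hb0).2 hb2)
  · positivity
  · have hM := hMpos n
    have hp := hreg.tailP_pos (M n)
    have hlog : Real.log (γ * M n / bq H0 ((wseq u n : ℝ) / vseq u β n)) ≤ Real.log (M n) := by
      refine Real.log_le_log (div_pos (mul_pos hγ.1 hM) hb0) ?_
      rw [div_le_iff₀ hb0]
      nlinarith [hγ.2]
    have hr2 : (q n / tailP H0 (M n)) ^ (2 - β) * tailP H0 (M n) ^ (2 - β) = q n ^ (2 - β) := by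
      rw [← Real.mul_rpow (by positivity) hp.le, div_mul_cancel₀ _ hp.ne']
    have hq2β : q n ^ (2 - β) * q n ^ β = q n ^ 2 := by
      rw [← Real.rpow_add hq, sub_add_cancel, Real.rpow_two]
    refine Real.le_sqrt_of_sq_le ?_
    have hL : Real.log (γ * M n / bq H0 ((wseq u n : ℝ) / vseq u β n)) ^ 2 ≤ Real.log (M n) ^ 2 :=
      pow_le_pow_left₀ hlog0 hlog 2
    have hR : 2 * ((q n / tailP H0 (M n)) ^ (2 - β) *
        ((n : ℝ) * tailP H0 (M n) ^ (2 - β) * Real.log (M n) ^ 2)) =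
        2 * n * q n ^ (2 - β) * Real.log (M n) ^ 2 := by
      rw [← hr2]; ring
    rw [hR, mul_pow, div_pow, Real.sq_sqrt hv0.le]
    refine mul_le_mul ?_ hL (sq_nonneg _) (by positivity)
    rw [div_le_iff₀ hv0]
    calc ((wseq u n : ℝ) * q n) ^ 2 ≤ ((n : ℝ) * q n) ^ 2 := by gcongr
      _ = 2 * n * q n ^ (2 - β) * ((n : ℝ) * q n ^ β / 2) := by
        linear_combination (-(n : ℝ) ^ 2) * hq2β
      _ ≤ 2 * n * q n ^ (2 - β) * vseq u β n := by
        gcongr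
        exact hv.1
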